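/- arXiv:2210.03784 — 6 statements merged into one kernel-verified Lean document; each statement's English description precedes it below -/
import Mathlib

section
/- Let (G, ·, r, 1) be a commutative multigroup. If G has the strong inversion property — i.e., for every a ∈ G there is a unique b ∈ G with a·b = {1} (and then b = r(a)) — then the multioperation of G is single-valued, i.e. a·b is a singleton for all a, b ∈ G, so that G is an (abelian) group. -/
universe u

/-- A structure carrying a multivalued binary operation, an inversion map and a unit. -/
structure MultigroupStruct (G : Type u) where
  mul : G → G → Set G
  inv : G → G
  one : G

/-- The axioms of a commutative multigroup. -/
structure IsMultigroup {G : Type u} (M : MultigroupStruct G) : Prop where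
  M1 : ∀ a b c : G, c ∈ M.mul a b → a ∈ M.mul c (M.inv b) ∧ b ∈ M.mul (M.inv a) c
  M2 : ∀ a b : G, b ∈ M.mul a M.one ↔ a = b
  M3 : ∀ a b c x t : G, x ∈ M.mul a b → t ∈ M.mul x c → ∃ y ∈ M.mul b c, t ∈ M.mul a y
  M4 : ∀ a b c : G, c ∈ M.mul a b ↔ c ∈ M.mul b a

/-- If a commutative multigroup has the strong inversion property (for every `a` there is a
unique `b` with `a·b = {1}`, and then `b = r a`), then its multioperation is single-valued:
`a·b` is a singleton for all `a, b`, so that `G` is an (abelian) group. -/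
theorem stmt_0 {G : Type u} [Nonempty G] (M : MultigroupStruct G) (hM : IsMultigroup M)
    (hSIP : ∀ a : G, ∃! b : G, M.mul a b = {M.one})
    (hSIPinv : ∀ a b : G, M.mul a b = {M.one} → b = M.inv a) :
    ∀ a b : G, ∃ c : G, M.mul a b = {c} := by
  have key : ∀ a y : G, y ∈ M.mul (M.inv a) a ↔ y = M.one := by
    intro a y
    obtain ⟨b, hb, -⟩ := hSIP a
    have hb' : M.mul a b = {M.one} := hb
    have e := hSIPinv a b hb'
    subst e
    rw [hM.M4, hb']
    rfl
  intro a b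
  have hne : ∃ c, c ∈ M.mul a b := by
    obtain ⟨y, hy, -⟩ := hM.M3 (M.inv a) a b M.one b ((key a M.one).2 rfl)
      ((hM.M4 _ _ _).1 ((hM.M2 b b).2 rfl))
    exact ⟨y, hy⟩
  obtain ⟨c, hc⟩ := hne
  refine ⟨c, Set.eq_singleton_iff_unique_mem.2 ⟨hc, ?_⟩⟩
  intro d hd
  obtain ⟨y, hy, hdy⟩ := hM.M3 c (M.inv a) a b d
    ((hM.M4 _ _ _).1 (hM.M1 a b c hc).2) ((hM.M4 _ _ _).1 hd)
  rw [(key a y).1 hy] at hdy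
  exact ((hM.M2 c d).1 hdy).symm
end

section
/- Let A be a full superdomain and let a ∈ A with a ≠ 0. If b, c ∈ A satisfy (a·b) ∩ (a·c) ≠ ∅, then b = c. -/
universe u v

/-- A structure carrying two multivalued (set-valued) binary operations, a negation,
a zero and a one, on a type `A`. -/
structure SuperringStruct (A : Type u) where
  add : A → A → Set A
  mul : A → A → Set A
  neg : A → A
  zero : A
  one : A

namespace SuperringStruct

variable {A : Type u}

/-- Elementwise (multivalued) sum of two subsets: `X + Y = ⋃ {x + y : x ∈ X, y ∈ Y}`. -/
def sadd (R : SuperringStruct A) (X Y : Set A) : Set A := ⋃ x ∈ X, ⋃ y ∈ Y, R.add x y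

/-- Elementwise (multivalued) product of two subsets. -/
def smul (R : SuperringStruct A) (X Y : Set A) : Set A := ⋃ x ∈ X, ⋃ y ∈ Y, R.mul x y

end SuperringStruct

/-- The axioms of a superring. -/
structure IsSuperring {A : Type u} (R : SuperringStruct A) : Prop where
  add_nonempty : ∀ a b : A, (R.add a b).Nonempty
  mul_nonempty : ∀ a b : A, (R.mul a b).Nonempty
  add_comm : ∀ a b : A, R.add a b = R.add b a
  add_M1 : ∀ a b c : A, c ∈ R.add a b → a ∈ R.add c (R.neg b) ∧ b ∈ R.add (R.neg a) c
  add_M2 : ∀ a b : A, b ∈ R.add a R.zero ↔ a = b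
  add_M3 : ∀ a b c x t : A, x ∈ R.add a b → t ∈ R.add x c →
    ∃ y ∈ R.add b c, t ∈ R.add a y
  mul_comm : ∀ a b : A, R.mul a b = R.mul b a
  mul_M3 : ∀ a b c x t : A, x ∈ R.mul a b → t ∈ R.mul x c →
    ∃ y ∈ R.mul b c, t ∈ R.mul a y
  one_mul_mem : ∀ a : A, a ∈ R.mul R.one a
  mul_zero : ∀ a : A, R.mul a R.zero = {R.zero}
  distrib : ∀ a b c x d : A, x ∈ R.add a b → d ∈ R.mul c x →
    d ∈ R.sadd (R.mul c a) (R.mul c b)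
  neg_mul : ∀ a b : A, R.neg '' R.mul a b = R.mul (R.neg a) b
  mul_neg : ∀ a b : A, R.neg '' R.mul a b = R.mul a (R.neg b)

theorem IsSuperring.neg_zero {A : Type u} {R : SuperringStruct A} (h : IsSuperring R) :
    R.neg R.zero = R.zero := by
  have h0 : R.zero ∈ R.add R.zero R.zero := (h.add_M2 R.zero R.zero).mpr rfl
  exact (h.add_M2 _ _).mp (h.add_M1 _ _ _ h0).2

/-- A superring is *full* if `d ∈ c·(a+b)` iff `d ∈ c·a + c·b`. -/
def SuperringStruct.IsFull {A : Type u} (R : SuperringStruct A) : Prop :=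
  ∀ a b c d : A, (∃ x ∈ R.add a b, d ∈ R.mul c x) ↔ d ∈ R.sadd (R.mul c a) (R.mul c b)

/-- A superdomain: a superring with `0 ≠ 1` and no zero divisors. -/
def IsSuperdomain {A : Type u} (R : SuperringStruct A) : Prop :=
  IsSuperring R ∧ R.zero ≠ R.one ∧
    ∀ a b : A, R.zero ∈ R.mul a b → a = R.zero ∨ b = R.zero

/-- A superfield: a superdomain in which every nonzero element is invertible. -/
def IsSuperfield {A : Type u} (R : SuperringStruct A) : Prop :=
  IsSuperdomain R ∧ ∀ a : A, a ≠ R.zero → ∃ b : A, R.one ∈ R.mul a b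

/-- A hyperfield: a superring with single-valued product, `0 ≠ 1`,
and multiplicative inverses for nonzero elements. -/
def IsHyperfield {A : Type u} (R : SuperringStruct A) : Prop :=
  IsSuperring R ∧ (∀ a b : A, ∃ c : A, R.mul a b = {c}) ∧ R.zero ≠ R.one ∧
    ∀ a : A, a ≠ R.zero → ∃ b : A, R.one ∈ R.mul a b

/-- An ideal of a superring: a nonempty subset `I` with `I + I ⊆ I` and `A·I ⊆ I`. -/
def IsIdeal {A : Type u} (R : SuperringStruct A) (I : Set A) : Prop :=
  I.Nonempty ∧ R.sadd I I ⊆ I ∧ R.smul Set.univ I ⊆ I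

/-- A prime ideal: `1 ∉ p` and `a·b ⊆ p` implies `a ∈ p` or `b ∈ p`. -/
def IsPrimeIdeal {A : Type u} (R : SuperringStruct A) (I : Set A) : Prop :=
  R.one ∉ I ∧ ∀ a b : A, R.mul a b ⊆ I → a ∈ I ∨ b ∈ I

/-- A strongly prime ideal: `1 ∉ p` and `(a·b) ∩ p ≠ ∅` implies `a ∈ p` or `b ∈ p`. -/
def IsStronglyPrimeIdeal {A : Type u} (R : SuperringStruct A) (I : Set A) : Prop :=
  R.one ∉ I ∧ ∀ a b : A, (R.mul a b ∩ I).Nonempty → a ∈ I ∨ b ∈ I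

/-- A maximal ideal: `1 ∉ m` and the only ideals containing `m` are `m` and the whole ring. -/
def IsMaximalIdeal {A : Type u} (R : SuperringStruct A) (I : Set A) : Prop :=
  R.one ∉ I ∧ ∀ J : Set A, IsIdeal R J → I ⊆ J → J = I ∨ J = Set.univ

/-- The ideal generated by an element: the intersection of all ideals containing it. -/
def genIdeal {A : Type u} (R : SuperringStruct A) (a : A) : Set A :=
  ⋂₀ {I : Set A | IsIdeal R I ∧ a ∈ I}

/-- Two elements are identified in the quotient `A/I` iff they have the same coset `x + I`. -/
def cosetRel {A : Type u} (R : SuperringStruct A) (I : Set A) (x y : A) : Prop :=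
  R.sadd {x} I = R.sadd {y} I

/-- The quotient superring structure `A/I`, with classes `x̄ = x + I` and
multioperations `x̄ + ȳ = {z̄ : z ∈ x + y}`, `x̄·ȳ = {z̄ : z ∈ x·y}`, `-x̄ = (-x)‾`. -/
noncomputable def quotStruct {A : Type u} (R : SuperringStruct A) (I : Set A) :
    SuperringStruct (Quot (cosetRel R I)) where
  add X Y := {Z | ∃ x y z : A,
    Quot.mk _ x = X ∧ Quot.mk _ y = Y ∧ Quot.mk _ z = Z ∧ z ∈ R.add x y}
  mul X Y := {Z | ∃ x y z : A,
    Quot.mk _ x = X ∧ Quot.mk _ y = Y ∧ Quot.mk _ z = Z ∧ z ∈ R.mul x y}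
  neg X := Quot.mk _ (R.neg X.out)
  zero := Quot.mk _ R.zero
  one := Quot.mk _ R.one

/-- A morphism of superrings. -/
def IsMorphism {A : Type u} {B : Type v} (R : SuperringStruct A) (S : SuperringStruct B)
    (f : A → B) : Prop :=
  f R.zero = S.zero ∧ f R.one = S.one ∧ (∀ a : A, f (R.neg a) = S.neg (f a)) ∧
    (∀ a b c : A, c ∈ R.add a b → f c ∈ S.add (f a) (f b)) ∧
    (∀ a b c : A, c ∈ R.mul a b → f c ∈ S.mul (f a) (f b))

/-- Marshall's relation: `a ∼_S b` iff `a·X = b·Y` for some nonempty `X, Y ⊆ S`. -/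
def msRel {A : Type u} (R : SuperringStruct A) (S : Set A) (a b : A) : Prop :=
  ∃ X Y : Set A, X ⊆ S ∧ X.Nonempty ∧ Y ⊆ S ∧ Y.Nonempty ∧ R.smul {a} X = R.smul {b} Y

/-- A Marshall coherent subset: multiplicative, and whenever `x ∈ a·s` with `s ∈ S`,
there are nonempty `P, Q ⊆ S` with `x·P = a·Q`. -/
def MarshallCoherent {A : Type u} (R : SuperringStruct A) (S : Set A) : Prop :=
  R.one ∈ S ∧ (∀ s ∈ S, ∀ v ∈ S, R.mul s v ⊆ S) ∧
    ∀ a x : A, ∀ s ∈ S, x ∈ R.mul a s →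
      ∃ P Q : Set A, P ⊆ S ∧ P.Nonempty ∧ Q ⊆ S ∧ Q.Nonempty ∧
        R.smul {x} P = R.smul {a} Q

/-- The Marshall quotient superring structure `A/_m S` on the classes of `∼_S`. -/
noncomputable def marshallStruct {A : Type u} (R : SuperringStruct A) (S : Set A) :
    SuperringStruct (Quot (msRel R S)) where
  add X Y := {Z | ∃ a b c : A,
    Quot.mk _ a = X ∧ Quot.mk _ b = Y ∧ Quot.mk _ c = Z ∧ c ∈ R.add a b}
  mul X Y := {Z | ∃ a b c : A,
    Quot.mk _ a = X ∧ Quot.mk _ b = Y ∧ Quot.mk _ c = Z ∧ c ∈ R.mul a b}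
  neg X := Quot.mk _ (R.neg X.out)
  zero := Quot.mk _ R.zero
  one := Quot.mk _ R.one

/-- Finite multivalued sums: `x ∈ Σ_{i<0} g i` iff `x = 0`;
`Σ_{i<p+1} g i = (Σ_{i<p} g i) + g p` elementwise. -/
def setSumUpTo {A : Type u} (R : SuperringStruct A) (g : ℕ → Set A) : ℕ → Set A
  | 0 => {R.zero}
  | n + 1 => R.sadd (setSumUpTo R g n) (g n)

/-- Multivalued powers: `α^0 = {1}`, `α^{n+1} = α^n · α` elementwise. -/
def setPow {A : Type u} (R : SuperringStruct A) (α : A) : ℕ → Set A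
  | 0 => {R.one}
  | n + 1 => R.smul (setPow R α n) {α}

/-- The evaluation set `c 0 + c 1 · α + ⋯ + c m · α^m` (a finite multivalued sum of
multivalued products). -/
def evalSet {A : Type u} (R : SuperringStruct A) (c : ℕ → A) (m : ℕ) (α : A) : Set A :=
  setSumUpTo R (fun j => R.smul {c j} (setPow R α j)) (m + 1)

/-- The iterated multivalued product of a list: `Π_{i<0} = {1}` and
`t ∈ f₁·…·fₙ` iff `t ∈ y·fₙ` for some `y ∈ f₁·…·f_{n-1}`. -/
def listProd {A : Type u} (R : SuperringStruct A) (l : List A) : Set A :=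
  l.foldl (fun X a => R.smul X {a}) {R.one}

/-- The carrier of `R[X]`: eventually-zero sequences in `R`. -/
def PolyCarrier {A : Type u} (R : SuperringStruct A) : Type u :=
  {f : ℕ → A // ∃ N : ℕ, ∀ n : ℕ, N ≤ n → f n = R.zero}

/-- The superring of polynomials `R[X]` with the convolution multioperations. -/
def polyStruct {A : Type u} (R : SuperringStruct A) (h : IsSuperring R) :
    SuperringStruct (PolyCarrier R) where
  add f g := {c | ∀ n : ℕ, c.1 n ∈ R.add (f.1 n) (g.1 n)}
  mul f g := {c | ∀ n : ℕ,
    c.1 n ∈ setSumUpTo R (fun j => R.mul (f.1 j) (g.1 (n - j))) (n + 1)}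
  neg f := ⟨fun n => R.neg (f.1 n), by
    obtain ⟨N, hN⟩ := f.2
    exact ⟨N, fun n hn => by
      show R.neg (f.1 n) = R.zero
      rw [hN n hn, h.neg_zero]⟩⟩
  zero := ⟨fun _ => R.zero, ⟨0, fun _ _ => rfl⟩⟩
  one := ⟨fun n => if n = 0 then R.one else R.zero, ⟨1, fun n hn => if_neg (by omega)⟩⟩

/-- The degree of a polynomial: the largest `n` with nonzero `n`-th coefficient. -/
noncomputable def polyDeg {A : Type u} (R : SuperringStruct A) (f : PolyCarrier R) : ℕ :=
  sSup {n : ℕ | f.1 n ≠ R.zero}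

/-- The constant polynomial. -/
def constPoly {A : Type u} (R : SuperringStruct A) (a : A) : PolyCarrier R :=
  ⟨fun n => if n = 0 then a else R.zero, ⟨1, fun n hn => if_neg (by omega)⟩⟩

/-- The monomial `d·X^r`. -/
def monoPoly {A : Type u} (R : SuperringStruct A) (d : A) (r : ℕ) : PolyCarrier R :=
  ⟨fun n => if n = r then d else R.zero, ⟨r + 1, fun n hn => if_neg (by omega)⟩⟩

/-- The polynomial `X`. -/
def XPoly {A : Type u} (R : SuperringStruct A) : PolyCarrier R :=
  ⟨fun n => if n = 1 then R.one else R.zero, ⟨2, fun n hn => if_neg (by omega)⟩⟩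

/-- The polynomial `X - a = (-a, 1, 0, …)`. -/
def XsubC {A : Type u} (R : SuperringStruct A) (a : A) : PolyCarrier R :=
  ⟨fun n => if n = 0 then R.neg a else if n = 1 then R.one else R.zero,
   ⟨2, fun n hn => by
     show (if n = 0 then R.neg a else if n = 1 then R.one else R.zero) = R.zero
     rw [if_neg (by omega), if_neg (by omega)]⟩⟩

/-- The polynomial obtained from `g` by putting `d` in the `r`-th coefficient. -/
def putCoeff {A : Type u} (R : SuperringStruct A) (g : PolyCarrier R) (d : A) (r : ℕ) :
    PolyCarrier R :=
  ⟨fun n => if n = r then d else g.1 n, by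
    obtain ⟨N, hN⟩ := g.2
    exact ⟨max N (r + 1), fun n hn => by
      show (if n = r then d else g.1 n) = R.zero
      rw [if_neg (by omega), hN n (by omega)]⟩⟩

/-- A polynomial `f` is irreducible if `deg f ≥ 1` and `f ∈ ⟨u⟩` implies `⟨f⟩ = ⟨u⟩`. -/
noncomputable def IsIrreduciblePoly {A : Type u} (R : SuperringStruct A) (h : IsSuperring R)
    (f : PolyCarrier R) : Prop :=
  1 ≤ polyDeg R f ∧ ∀ u : PolyCarrier R, f ∈ genIdeal (polyStruct R h) u →
    genIdeal (polyStruct R h) f = genIdeal (polyStruct R h) u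

/-- In a full superdomain, multiplication by a nonzero element is cancellable:
if `(a·b) ∩ (a·c) ≠ ∅` with `a ≠ 0`, then `b = c`. -/
theorem stmt_1 {A : Type u} (R : SuperringStruct A) (hd : IsSuperdomain R)
    (hfull : R.IsFull) (a b c : A) (ha : a ≠ R.zero)
    (hbc : (R.mul a b ∩ R.mul a c).Nonempty) : b = c := by
  obtain ⟨h, -, hz⟩ := hd
  obtain ⟨d, hdb, hdc⟩ := hbc
  have hn : ∀ x : A, R.zero ∈ R.add (R.neg x) x := fun x =>
    (h.add_M1 x R.zero x ((h.add_M2 x x).mpr rfl)).2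
  have key : ∀ y : A, R.zero ∈ R.add (R.neg c) y → R.neg (R.neg c) = y := fun y hy =>
    (h.add_M2 _ _).mp (h.add_M1 _ _ _ hy).2
  have hnd : R.neg d ∈ R.mul a (R.neg c) := by
    rw [← h.mul_neg]
    exact ⟨d, hdc, rfl⟩
  obtain ⟨x, hx, hax⟩ := (hfull (R.neg c) b a R.zero).mpr (by
    simp only [SuperringStruct.sadd, Set.mem_iUnion]
    exact ⟨_, hnd, _, hdb, hn d⟩)
  have hx0 : x = R.zero := (hz a x hax).resolve_left ha
  subst hx0
  exact (key b hx).symm.trans (key c (hn c))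
end

section
/- Let A be a superring and I a maximal ideal of A. Then I is a prime ideal. -/
universe u v

/-- A maximal ideal of a superring is prime. -/
theorem stmt_3 {A : Type u} (R : SuperringStruct A) (h : IsSuperring R)
    (I : Set A) (hI : IsIdeal R I) (hm : IsMaximalIdeal R I) :
    IsPrimeIdeal R I := by
  refine ⟨hm.1, fun a b hab => ?_⟩
  obtain ⟨hne, hadd, hmul⟩ := hI
  have hadd' : ∀ x ∈ I, ∀ y ∈ I, ∀ z ∈ R.add x y, z ∈ I := fun x hx y hy z hz =>
    hadd (by simp only [SuperringStruct.sadd, Set.mem_iUnion]; exact ⟨x, hx, y, hy, hz⟩)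
  have hmul' : ∀ x, ∀ y ∈ I, ∀ z ∈ R.mul x y, z ∈ I := fun x y hy z hz =>
    hmul (by
      simp only [SuperringStruct.smul, Set.mem_iUnion]
      exact ⟨x, Set.mem_univ x, y, hy, hz⟩)
  have hIJ : I ⊆ {x | R.mul x b ⊆ I} := fun x hx t ht =>
    hmul' b x hx t (by rw [h.mul_comm]; exact ht)
  have hJ : IsIdeal R {x | R.mul x b ⊆ I} := by
    refine ⟨hne.mono hIJ, ?_, ?_⟩
    · intro z hz t ht
      simp only [SuperringStruct.sadd, Set.mem_iUnion] at hz
      obtain ⟨x, hx, y, hy, hz⟩ := hz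
      rw [h.mul_comm] at ht
      have hd := h.distrib x y b z t hz ht
      simp only [SuperringStruct.sadd, Set.mem_iUnion] at hd
      obtain ⟨p, hp, q, hq, htpq⟩ := hd
      rw [h.mul_comm] at hp hq
      exact hadd' p (hx hp) q (hy hq) t htpq
    · intro z hz t ht
      simp only [SuperringStruct.smul, Set.mem_iUnion] at hz
      obtain ⟨c, -, x, hx, hz⟩ := hz
      obtain ⟨y, hy, hty⟩ := h.mul_M3 c x b z t hz ht
      exact hmul' c y (hx hy) t hty
  rcases hm.2 _ hJ hIJ with hJI | hJu
  · left
    rw [← hJI]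
    exact hab
  · right
    have h1 : R.one ∈ {x | R.mul x b ⊆ I} := by rw [hJu]; exact Set.mem_univ _
    exact h1 (h.one_mul_mem b)
end

section
/- (Prime Ideal Theorem for superrings) Let A be a superring, I an ideal of A, and S ⊆ A a multiplicative set (1 ∈ S and S·S ⊆ S) with S ∩ I = ∅. Then there exists a prime ideal p of A such that I ⊆ p and S ∩ p = ∅. -/
universe u v

theorem isIdeal_colon {A : Type u} {R : SuperringStruct A} (h : IsSuperring R)
    {p : Set A} (hp : IsIdeal R p) (b : A) :
    IsIdeal R {x | R.mul x b ⊆ p} ∧ p ⊆ {x | R.mul x b ⊆ p} := by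
  obtain ⟨⟨z, hz⟩, hadd, hmul⟩ := hp
  have hadd' : ∀ x ∈ p, ∀ y ∈ p, ∀ t ∈ R.add x y, t ∈ p := fun x hx y hy t ht =>
    hadd (by simp only [SuperringStruct.sadd, Set.mem_iUnion]; exact ⟨x, hx, y, hy, ht⟩)
  have hmul' : ∀ r, ∀ x ∈ p, ∀ t ∈ R.mul r x, t ∈ p := fun r x hx t ht =>
    hmul (by simp only [SuperringStruct.smul, Set.mem_iUnion]
             exact ⟨r, Set.mem_univ r, x, hx, ht⟩)
  have hsub : p ⊆ {x | R.mul x b ⊆ p} := fun x hx t ht =>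
    hmul' b x hx t (by rw [h.mul_comm]; exact ht)
  refine ⟨⟨⟨z, hsub hz⟩, ?_, ?_⟩, hsub⟩
  · intro t ht d hd
    simp only [SuperringStruct.sadd, Set.mem_iUnion] at ht
    obtain ⟨x, hx, y, hy, ht⟩ := ht
    rw [h.mul_comm] at hd
    have hd2 := h.distrib x y b t d ht hd
    simp only [SuperringStruct.sadd, Set.mem_iUnion] at hd2
    obtain ⟨u, hu, w, hw, hd2⟩ := hd2
    rw [h.mul_comm] at hu hw
    exact hadd' u (hx hu) w (hy hw) d hd2
  · intro t ht d hd
    simp only [SuperringStruct.smul, Set.mem_iUnion] at ht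
    obtain ⟨r, -, x, hx, ht⟩ := ht
    obtain ⟨y, hy, hdy⟩ := h.mul_M3 r x b t d ht hd
    exact hmul' r y (hx hy) d hdy

/-- Prime Ideal Theorem for superrings: if `I` is an ideal disjoint from a multiplicative
set `S`, then there is a prime ideal `p ⊇ I` disjoint from `S`. -/
theorem stmt_5 {A : Type u} (R : SuperringStruct A) (h : IsSuperring R)
    (I : Set A) (hI : IsIdeal R I) (S : Set A) (hS1 : R.one ∈ S)
    (hSmul : ∀ s ∈ S, ∀ v ∈ S, R.mul s v ⊆ S) (hdisj : S ∩ I = ∅) :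
    ∃ p : Set A, IsIdeal R p ∧ IsPrimeIdeal R p ∧ I ⊆ p ∧ S ∩ p = ∅ := by
  obtain ⟨p, hIp, hpm⟩ := zorn_subset_nonempty {J : Set A | IsIdeal R J ∧ S ∩ J = ∅} (by
    intro c hc hch hne
    obtain ⟨J₀, hJ₀⟩ := hne
    refine ⟨⋃₀ c, ⟨⟨?_, ?_, ?_⟩, ?_⟩, fun J hJ => Set.subset_sUnion_of_mem hJ⟩
    · obtain ⟨z, hz⟩ := (hc hJ₀).1.1
      exact ⟨z, J₀, hJ₀, hz⟩
    · intro t ht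
      simp only [SuperringStruct.sadd, Set.mem_iUnion] at ht
      obtain ⟨x, ⟨J, hJ, hx⟩, y, ⟨K, hK, hy⟩, ht⟩ := ht
      rcases hch.total hJ hK with hJK | hJK
      · refine ⟨K, hK, (hc hK).1.2.1 ?_⟩
        simp only [SuperringStruct.sadd, Set.mem_iUnion]
        exact ⟨x, hJK hx, y, hy, ht⟩
      · refine ⟨J, hJ, (hc hJ).1.2.1 ?_⟩
        simp only [SuperringStruct.sadd, Set.mem_iUnion]
        exact ⟨x, hx, y, hJK hy, ht⟩
    · intro t ht
      simp only [SuperringStruct.smul, Set.mem_iUnion] at ht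
      obtain ⟨r, hr, x, ⟨J, hJ, hx⟩, ht⟩ := ht
      refine ⟨J, hJ, (hc hJ).1.2.2 ?_⟩
      simp only [SuperringStruct.smul, Set.mem_iUnion]
      exact ⟨r, hr, x, hx, ht⟩
    · refine Set.eq_empty_iff_forall_notMem.mpr ?_
      rintro t ⟨htS, J, hJ, htJ⟩
      exact Set.eq_empty_iff_forall_notMem.mp (hc hJ).2 t ⟨htS, htJ⟩) I ⟨hI, hdisj⟩
  obtain ⟨hpI, hpS⟩ := hpm.prop
  have hpS' := Set.eq_empty_iff_forall_notMem.mp hpS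
  -- colon ideals strictly larger than `p` meet `S`
  have key : ∀ a b : A, a ∉ p → R.mul a b ⊆ p → ∃ s ∈ S, R.mul s b ⊆ p := by
    intro a b ha hab
    by_contra hcon
    push Not at hcon
    obtain ⟨hK, hpK⟩ := isIdeal_colon h hpI b
    exact ha (hpm.le_of_ge ⟨hK, Set.eq_empty_iff_forall_notMem.mpr
      fun t ht => hcon t ht.1 ht.2⟩ hpK hab)
  refine ⟨p, hpI, ⟨fun h1 => hpS' _ ⟨hS1, h1⟩, ?_⟩, hIp, hpS⟩
  intro a b hab
  by_contra hcon
  push Not at hcon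
  obtain ⟨s, hs, hsb⟩ := key a b hcon.1 hab
  rw [h.mul_comm] at hsb
  obtain ⟨t, ht, hts⟩ := key b s hcon.2 hsb
  obtain ⟨d, hd⟩ := h.mul_nonempty t s
  exact hpS' d ⟨hSmul t ht s hs hd, hts hd⟩
end

section
/- Let R be a superdomain and f, g ∈ R[X] both nonzero. If t ∈ f·g then deg(t) = deg(f) + deg(g). More generally, if f_1, …, f_n ∈ R[X] are nonzero and t ∈ f_1·f_2·…·f_n, then deg(t) = deg(f_1) + ⋯ + deg(f_n). In particular (partial factorization degree), if f ∈ (X−a_1)·(X−a_2)·…·(X−a_p) for elements a_1, …, a_p ∈ R, then deg(f) = p. -/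
universe u v

theorem mem_sadd7 {A : Type u} (R : SuperringStruct A) (X Y : Set A) (z : A) :
    z ∈ R.sadd X Y ↔ ∃ x ∈ X, ∃ y ∈ Y, z ∈ R.add x y := by
  simp [SuperringStruct.sadd]

theorem mem_smul7 {A : Type u} (R : SuperringStruct A) (X Y : Set A) (z : A) :
    z ∈ R.smul X Y ↔ ∃ x ∈ X, ∃ y ∈ Y, z ∈ R.mul x y := by
  simp [SuperringStruct.smul]

theorem sum_aux7 {A : Type u} {R : SuperringStruct A} (h : IsSuperring R) (g : ℕ → Set A)
    (k : ℕ) (n : ℕ) : ∀ x, (∀ j < n, j ≠ k → ∀ y ∈ g j, y = R.zero) →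
    x ∈ setSumUpTo R g n → (n ≤ k → x = R.zero) ∧ (k < n → x ∈ g k) := by
  induction n with
  | zero =>
    intro x _ hx
    exact ⟨fun _ => hx, fun hk => absurd hk (by omega)⟩
  | succ n ih =>
    intro x hg hx
    obtain ⟨y, hy, z, hz, hxyz⟩ := (mem_sadd7 R _ _ _).1 hx
    have ihy := ih y (fun j hj => hg j (by omega)) hy
    rcases eq_or_ne n k with hnk | hnk
    · have hy0 := ihy.1 (by omega)
      rw [hy0, h.add_comm] at hxyz
      have hzx := (h.add_M2 _ _).1 hxyz
      subst hzx
      subst hnk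
      exact ⟨fun hk => absurd hk (by omega), fun _ => hz⟩
    · have hz0 := hg n (by omega) hnk z hz
      rw [hz0] at hxyz
      have hyx := (h.add_M2 _ _).1 hxyz
      subst hyx
      exact ⟨fun hk => ihy.1 (by omega), fun hk => ihy.2 (by omega)⟩

/-- `f` has degree exactly `n`. -/
def HasDeg7 {A : Type u} (R : SuperringStruct A) (f : PolyCarrier R) (n : ℕ) : Prop :=
  f.1 n ≠ R.zero ∧ ∀ m, n < m → f.1 m = R.zero

theorem HasDeg7.deg {A : Type u} {R : SuperringStruct A} {f : PolyCarrier R} {n : ℕ}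
    (hf : HasDeg7 R f n) : polyDeg R f = n := by
  have : IsGreatest {n : ℕ | f.1 n ≠ R.zero} n :=
    ⟨hf.1, fun m hm => by
      by_contra hlt
      exact hm (hf.2 m (by omega))⟩
  exact this.csSup_eq

theorem hasDeg7_of_ne {A : Type u} {R : SuperringStruct A} (h : IsSuperring R)
    {f : PolyCarrier R} (hf : f ≠ (polyStruct R h).zero) : HasDeg7 R f (polyDeg R f) := by
  have hne : {n : ℕ | f.1 n ≠ R.zero}.Nonempty := by
    by_contra hemp
    apply hf
    apply Subtype.ext
    funext n
    by_contra hn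
    exact hemp ⟨n, hn⟩
  have hbdd : BddAbove {n : ℕ | f.1 n ≠ R.zero} := by
    obtain ⟨N, hN⟩ := f.2
    refine ⟨N, fun m hm => ?_⟩
    by_contra hlt
    exact hm (hN m (by omega))
  refine ⟨Nat.sSup_mem hne hbdd, fun m hm => ?_⟩
  by_contra hc
  have : m ≤ polyDeg R f := le_csSup hbdd hc
  omega

theorem mul_deg7 {A : Type u} {R : SuperringStruct A} (h : IsSuperring R)
    (hd : IsSuperdomain R) {f g t : PolyCarrier R} {p q : ℕ} (hf : HasDeg7 R f p)
    (hg : HasDeg7 R g q) (ht : t ∈ (polyStruct R h).mul f g) : HasDeg7 R t (p + q) := by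
  have hmr : ∀ a x, x ∈ R.mul a R.zero → x = R.zero := by
    intro a x hx
    rw [h.mul_zero] at hx
    exact hx
  have hml : ∀ a x, x ∈ R.mul R.zero a → x = R.zero := by
    intro a x hx
    rw [h.mul_comm] at hx
    exact hmr a x hx
  constructor
  · intro h0
    have := (sum_aux7 h _ p (p + q + 1) _ (fun j hj hjp y hy => ?_) (ht (p + q))).2 (by omega)
    · rw [h0] at this
      simp only [Nat.add_sub_cancel_left] at this
      rcases hd.2.2 _ _ this with h1 | h1
      · exact hf.1 h1
      · exact hg.1 h1
    · rcases lt_or_gt_of_ne hjp with hlt | hlt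
      · simp only [hg.2 (p + q - j) (by omega)] at hy
        exact hmr _ _ hy
      · simp only [hf.2 j hlt] at hy
        exact hml _ _ hy
  · intro m hm
    refine (sum_aux7 h _ (m + 1) (m + 1) _ (fun j hj _ y hy => ?_) (ht m)).1 le_rfl
    rcases lt_or_ge p j with hlt | hlt
    · simp only [hf.2 j hlt] at hy
      exact hml _ _ hy
    · simp only [hg.2 (m - j) (by omega)] at hy
      exact hmr _ _ hy

theorem foldl_deg7 {A : Type u} {R : SuperringStruct A} (h : IsSuperring R)
    (hd : IsSuperdomain R) (l : List (PolyCarrier R)) :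
    ∀ (X : Set (PolyCarrier R)) (p : ℕ), (∀ x ∈ X, HasDeg7 R x p) →
    (∀ f ∈ l, HasDeg7 R f (polyDeg R f)) →
    ∀ t ∈ l.foldl (fun X a => (polyStruct R h).smul X {a}) X,
      HasDeg7 R t (p + (l.map (polyDeg R)).sum) := by
  induction l with
  | nil =>
    intro X p hX _ t ht
    simpa using hX t ht
  | cons a l ih =>
    intro X p hX hl t ht
    have := ih ((polyStruct R h).smul X {a}) (p + polyDeg R a) (fun x hx => ?_)
      (fun f hf => hl f (List.mem_cons_of_mem _ hf)) t ht
    · simpa [add_assoc] using this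
    · obtain ⟨y, hy, z, hz, hxyz⟩ := (mem_smul7 _ _ _ _).1 hx
      obtain rfl : z = a := hz
      exact mul_deg7 h hd (hX y hy) (hl z List.mem_cons_self) hxyz

theorem listProd_deg7 {A : Type u} {R : SuperringStruct A} (h : IsSuperring R)
    (hd : IsSuperdomain R) (l : List (PolyCarrier R))
    (hl : ∀ f ∈ l, HasDeg7 R f (polyDeg R f)) (t : PolyCarrier R)
    (ht : t ∈ listProd (polyStruct R h) l) : polyDeg R t = (l.map (polyDeg R)).sum := by
  have := (foldl_deg7 h hd l {(polyStruct R h).one} 0 (fun x hx => ?_) hl t ht).deg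
  · simpa using this
  · obtain rfl : x = _ := hx
    refine ⟨fun h0 => hd.2.1 ?_, fun m hm => ?_⟩
    · simpa [polyStruct] using h0.symm
    · simp [polyStruct, hm.ne']

theorem XsubC_deg7 {A : Type u} {R : SuperringStruct A} (hd : IsSuperdomain R) (a : A) :
    HasDeg7 R (XsubC R a) 1 := by
  refine ⟨fun h0 => hd.2.1 ?_, fun m hm => ?_⟩
  · simpa [XsubC] using h0.symm
  · show (if m = 0 then R.neg a else if m = 1 then R.one else R.zero) = R.zero
    rw [if_neg (by omega), if_neg (by omega)]

/-- Degrees of multivalued products of nonzero polynomials over a superdomain: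
`t ∈ f·g` implies `deg t = deg f + deg g`; likewise for iterated products; in particular
if `f ∈ (X-a₁)·…·(X-aₚ)` then `deg f = p`. -/
theorem stmt_7 {A : Type u} (R : SuperringStruct A) (h : IsSuperring R)
    (hd : IsSuperdomain R) :
    (∀ f g t : PolyCarrier R, f ≠ (polyStruct R h).zero → g ≠ (polyStruct R h).zero →
      t ∈ (polyStruct R h).mul f g → polyDeg R t = polyDeg R f + polyDeg R g) ∧
    (∀ l : List (PolyCarrier R), (∀ f ∈ l, f ≠ (polyStruct R h).zero) →
      ∀ t ∈ listProd (polyStruct R h) l, polyDeg R t = (l.map (polyDeg R)).sum) ∧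
    (∀ l : List A, ∀ f ∈ listProd (polyStruct R h) (l.map (XsubC R)),
      polyDeg R f = l.length) := by
  refine ⟨fun f g t hf hg ht => ?_, fun l hl t ht => ?_, fun l f hf => ?_⟩
  · exact (mul_deg7 h hd (hasDeg7_of_ne h hf) (hasDeg7_of_ne h hg) ht).deg
  · exact listProd_deg7 h hd l (fun f hf => hasDeg7_of_ne h (hl f hf)) t ht
  · rw [listProd_deg7 h hd _ ?_ f hf]
    · rw [List.map_map]
      have : (polyDeg R ∘ XsubC R) = fun _ => 1 := by
        funext a
        exact (XsubC_deg7 hd a).deg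
      simp [this]
    · intro g hg
      obtain ⟨a, _, rfl⟩ := List.mem_map.1 hg
      rw [(XsubC_deg7 hd a).deg]
      exact XsubC_deg7 hd a
end

section
/- Let R be a superring, f ∈ R[X], g ∈ R[X], d ∈ R, and r ∈ ℕ with r > deg(g). Then (g + dX^r)·f = g·f + dX^r·f, where g + dX^r denotes the single polynomial obtained from g by putting d in the r-th coefficient, and dX^r denotes the monomial with d in the r-th coefficient and 0 elsewhere. (That is, even though R[X] is in general only weakly distributive, multiplication by f distributes across the splitting of a polynomial into its lower part and its top monomial.) -/
universe u v

theorem aux_mem_sadd {A : Type u} (R : SuperringStruct A) (X Y : Set A) (t : A) :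
    t ∈ R.sadd X Y ↔ ∃ x ∈ X, ∃ y ∈ Y, t ∈ R.add x y := by
  simp [SuperringStruct.sadd]

theorem aux_sadd_comm {A : Type u} {R : SuperringStruct A} (h : IsSuperring R) (X Y : Set A) :
    R.sadd X Y = R.sadd Y X := by
  ext t
  simp only [aux_mem_sadd]
  constructor
  · rintro ⟨x, hx, y, hy, ht⟩
    exact ⟨y, hy, x, hx, h.add_comm x y ▸ ht⟩
  · rintro ⟨x, hx, y, hy, ht⟩
    exact ⟨y, hy, x, hx, h.add_comm x y ▸ ht⟩

theorem aux_sadd_assoc_sub {A : Type u} {R : SuperringStruct A} (h : IsSuperring R)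
    (X Y Z : Set A) : R.sadd (R.sadd X Y) Z ⊆ R.sadd X (R.sadd Y Z) := by
  intro t
  simp only [aux_mem_sadd]
  rintro ⟨w, ⟨x, hx, y, hy, hw⟩, z, hz, ht⟩
  obtain ⟨v, hv, htv⟩ := h.add_M3 _ _ _ _ _ hw ht
  exact ⟨x, hx, v, ⟨y, hy, z, hz, hv⟩, htv⟩

theorem aux_sadd_assoc {A : Type u} {R : SuperringStruct A} (h : IsSuperring R)
    (X Y Z : Set A) : R.sadd (R.sadd X Y) Z = R.sadd X (R.sadd Y Z) := by
  apply Set.Subset.antisymm (aux_sadd_assoc_sub h X Y Z)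
  rw [aux_sadd_comm h X (R.sadd Y Z), aux_sadd_comm h Y Z, aux_sadd_comm h (R.sadd X Y) Z,
    aux_sadd_comm h X Y]
  exact aux_sadd_assoc_sub h Z Y X

theorem aux_sadd_zero {A : Type u} {R : SuperringStruct A} (h : IsSuperring R) (X : Set A) :
    R.sadd X {R.zero} = X := by
  ext t
  simp [aux_mem_sadd, h.add_M2]

theorem aux_zero_sadd {A : Type u} {R : SuperringStruct A} (h : IsSuperring R) (X : Set A) :
    R.sadd {R.zero} X = X := by
  rw [aux_sadd_comm h, aux_sadd_zero h]

theorem aux_setSum_sadd {A : Type u} {R : SuperringStruct A} (h : IsSuperring R)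
    (P G M : ℕ → Set A) (hP : ∀ j, P j = R.sadd (G j) (M j)) (n : ℕ) :
    setSumUpTo R P n = R.sadd (setSumUpTo R G n) (setSumUpTo R M n) := by
  induction n with
  | zero => simp only [setSumUpTo]; rw [aux_sadd_zero h]
  | succ n ih =>
    simp only [setSumUpTo]
    rw [ih, hP, aux_sadd_assoc h, aux_sadd_assoc h, ← aux_sadd_assoc h _ (G n) (M n),
      ← aux_sadd_assoc h (G n), aux_sadd_comm h (setSumUpTo R M n) (G n)]

theorem aux_setSum_zero {A : Type u} {R : SuperringStruct A} (h : IsSuperring R)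
    (G : ℕ → Set A) (hG : ∀ j, G j = {R.zero}) (n : ℕ) :
    setSumUpTo R G n = {R.zero} := by
  induction n with
  | zero => rfl
  | succ n ih => simp only [setSumUpTo]; rw [ih, hG, aux_sadd_zero h]

theorem aux_zero_mul {A : Type u} {R : SuperringStruct A} (h : IsSuperring R) (a : A) :
    R.mul R.zero a = {R.zero} := by
  rw [h.mul_comm, h.mul_zero]

theorem aux_conv_zero {A : Type u} {R : SuperringStruct A} (h : IsSuperring R)
    (p q : PolyCarrier R) : ∃ N, ∀ n, N ≤ n →
      setSumUpTo R (fun j => R.mul (p.1 j) (q.1 (n - j))) (n + 1) = {R.zero} := by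
  obtain ⟨N, hN⟩ := p.2
  obtain ⟨K, hK⟩ := q.2
  refine ⟨N + K, fun n hn => aux_setSum_zero h _ (fun j => ?_) _⟩
  by_cases hj : N ≤ j
  · simp only [hN j hj]; exact aux_zero_mul h _
  · simp only [hK (n - j) (by omega)]; exact h.mul_zero _

theorem aux_deg {A : Type u} (R : SuperringStruct A) (g : PolyCarrier R) (r : ℕ)
    (hr : polyDeg R g < r) : g.1 r = R.zero := by
  by_contra hne
  obtain ⟨N, hN⟩ := g.2
  have hb : BddAbove {n : ℕ | g.1 n ≠ R.zero} := by
    refine ⟨N, fun n hn => ?_⟩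
    by_contra hlt
    exact hn (hN n (by omega))
  have : r ≤ polyDeg R g := le_csSup hb hne
  omega

/-- If `r > deg g`, then `(g + dX^r)·f = g·f + dX^r·f` in `R[X]` (as sets), where
`g + dX^r` is the single polynomial obtained from `g` by putting `d` in the `r`-th
coefficient. -/
theorem stmt_8 {A : Type u} (R : SuperringStruct A) (h : IsSuperring R)
    (f g : PolyCarrier R) (d : A) (r : ℕ) (hr : polyDeg R g < r) :
    (polyStruct R h).mul (putCoeff R g d r) f =
      (polyStruct R h).sadd ((polyStruct R h).mul g f)
        ((polyStruct R h).mul (monoPoly R d r) f) := by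
  have hgr := aux_deg R g r hr
  have key : ∀ n, setSumUpTo R (fun j => R.mul ((putCoeff R g d r).1 j) (f.1 (n - j))) (n + 1) =
      R.sadd (setSumUpTo R (fun j => R.mul (g.1 j) (f.1 (n - j))) (n + 1))
        (setSumUpTo R (fun j => R.mul ((monoPoly R d r).1 j) (f.1 (n - j))) (n + 1)) := by
    intro n
    apply aux_setSum_sadd h
    intro j
    by_cases hj : j = r
    · subst hj
      simp only [putCoeff, monoPoly, if_true, hgr]
      rw [aux_zero_mul h, aux_zero_sadd h]
    · simp only [putCoeff, monoPoly, if_neg hj]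
      rw [aux_zero_mul h, aux_sadd_zero h]
  ext c
  rw [aux_mem_sadd]
  constructor
  · intro hc
    have hc' : ∀ n, ∃ x ∈ setSumUpTo R (fun j => R.mul (g.1 j) (f.1 (n - j))) (n + 1),
        ∃ y ∈ setSumUpTo R (fun j => R.mul ((monoPoly R d r).1 j) (f.1 (n - j))) (n + 1),
          c.1 n ∈ R.add x y := by
      intro n
      rw [← aux_mem_sadd, ← key n]
      exact hc n
    choose x hx y hy hxy using hc'
    obtain ⟨N, hN⟩ := aux_conv_zero h g f
    obtain ⟨K, hK⟩ := aux_conv_zero h (monoPoly R d r) f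
    refine ⟨⟨x, N, fun n hn => ?_⟩, hx, ⟨y, K, fun n hn => ?_⟩, hy, hxy⟩
    · have := hx n
      rw [hN n hn] at this
      exact this
    · have := hy n
      rw [hK n hn] at this
      exact this
  · rintro ⟨x, hx, y, hy, hxy⟩ n
    rw [key n, aux_mem_sadd]
    exact ⟨_, hx n, _, hy n, hxy n⟩
end
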